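/- Let p, q ∈ A be projections, x ∈ S_p(X) and y ∈ S_q(X). Then ‖p − q‖ ≤ ‖x − y‖² + 2‖x − y‖·‖y‖. -/

import Mathlib

/-- A right Hilbert C*-module structure on `X` over the C*-algebra `A`:
`X` is a right `A`-module with an `A`-valued inner product satisfying
`⟨x,y⟩* = ⟨y,x⟩`, `⟨x, y·a⟩ = ⟨x,y⟩·a`, `⟨x,x⟩ ≥ 0`, and the norm of `X`
satisfies `‖x‖² = ‖⟨x,x⟩‖` (so completeness of `X` is completeness for this norm). -/
structure CStarModuleStr (A X : Type*) [NormedRing A] [StarRing A] [CStarRing A]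
    [PartialOrder A] [StarOrderedRing A] [NormedAddCommGroup X] where
  smul : X → A → X
  inner : X → X → A
  add_smul : ∀ x y a, smul (x + y) a = smul x a + smul y a
  smul_add : ∀ x a b, smul x (a + b) = smul x a + smul x b
  smul_mul : ∀ x a b, smul (smul x a) b = smul x (a * b)
  inner_add_left : ∀ x y z, inner (x + y) z = inner x z + inner y z
  inner_add_right : ∀ x y z, inner x (y + z) = inner x y + inner x z
  star_inner : ∀ x y, star (inner x y) = inner y x
  inner_smul_right : ∀ x y a, inner x (smul y a) = inner x y * a
  inner_self_nonneg : ∀ x, 0 ≤ inner x x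
  norm_sq_eq : ∀ x, ‖x‖ ^ 2 = ‖inner x x‖

variable {A X : Type*} [NormedRing A] [StarRing A] [CStarRing A]
  [PartialOrder A] [StarOrderedRing A] [CompleteSpace A]
  [NormedAddCommGroup X] [CompleteSpace X]

theorem proj_norm_cases {A : Type*} [NormedRing A] [StarRing A] [CStarRing A] (e : A)
    (he : e * e = e) (hs : star e = e) : ‖e‖ = 0 ∨ ‖e‖ = 1 := by
  have h : ‖star e * e‖ = ‖e‖ * ‖e‖ := CStarRing.norm_star_mul_self
  rw [hs, he] at h
  have : ‖e‖ * (‖e‖ - 1) = 0 := by linarith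
  rcases mul_eq_zero.1 this with h | h
  · exact Or.inl h
  · exact Or.inr (by linarith)

theorem norm_proj_mul_le {A X : Type*} [NormedRing A] [StarRing A] [CStarRing A]
    [PartialOrder A] [StarOrderedRing A] [NormedAddCommGroup X]
    (M : CStarModuleStr A X) (p q : A)
    (hp : p * p = p) (hps : star p = p) (hq : q * q = q) (hqs : star q = q)
    (x y : X) (hx : M.inner x x = p) (hy : M.inner y y = q) :
    ‖p * (1 - q)‖ ≤ ‖x - y‖ := by
  obtain ⟨e, he⟩ : ∃ e, e = 1 - q := ⟨_, rfl⟩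
  have hee : e * e = e := by subst he; simp [mul_sub, sub_mul, hq]
  have hes : star e = e := by subst he; simp [hqs]
  have hqe : q * e = 0 := by subst he; simp [mul_sub, hq]
  have h0 : ∀ u, M.inner u 0 = 0 := fun u => by
    have := M.inner_add_right u 0 0
    simpa using this
  have hye : M.smul y e = 0 := by
    have h1 : M.inner (M.smul y e) (M.smul y e) = 0 := by
      rw [M.inner_smul_right, ← M.star_inner, M.inner_smul_right, hy, hqe]; simp
    have h2 := M.norm_sq_eq (M.smul y e)
    rw [h1, norm_zero] at h2
    exact norm_eq_zero.1 (pow_eq_zero_iff (by norm_num) |>.1 h2)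
  have hxy : ∀ u, M.inner u y * e = 0 := fun u => by
    rw [← M.inner_smul_right, hye, h0]
  have hyx : ∀ u, e * M.inner y u = 0 := fun u => by
    have := congrArg star (hxy u)
    simpa [hes, M.star_inner] using this
  obtain ⟨z, hz⟩ : ∃ z, z = x - y := ⟨_, rfl⟩
  have hxz : x = z + y := by rw [hz]; abel
  have key : e * M.inner z z * e = star (p * e) * (p * e) := by
    have h1 : e * p * e = e * M.inner z z * e := by
      rw [← hx, hxz, M.inner_add_left, M.inner_add_right, mul_add, hyx, add_zero, mul_add,
        add_mul, mul_assoc e (M.inner z y), hxy, mul_zero, add_zero]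
    rw [← h1, star_mul, hes, hps, mul_assoc e p (p * e), ← mul_assoc p p e, hp, mul_assoc]
  rw [← he, ← hz]
  have hn : ‖e‖ ≤ 1 := by rcases proj_norm_cases e hee hes with h | h <;> rw [h] <;> norm_num
  have h3 : ‖p * e‖ * ‖p * e‖ ≤ ‖z‖ ^ 2 := by
    rw [← CStarRing.norm_star_mul_self, ← key, M.norm_sq_eq]
    calc _ ≤ ‖e‖ * ‖M.inner z z‖ * ‖e‖ :=
          (norm_mul_le _ _).trans (by gcongr; exact norm_mul_le _ _)
      _ ≤ 1 * ‖M.inner z z‖ * 1 := by gcongr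
      _ = _ := by ring
  exact abs_le_of_sq_le_sq' (by nlinarith) (norm_nonneg _) |>.2

/-- For projections `p, q ∈ A`, `x ∈ S_p(X)` and `y ∈ S_q(X)` one has
`‖p - q‖ ≤ ‖x - y‖² + 2‖x - y‖·‖y‖`. -/
theorem norm_proj_sub_le (M : CStarModuleStr A X) (p q : A)
    (hp : p * p = p) (hps : star p = p) (hq : q * q = q) (hqs : star q = q)
    (x y : X) (hx : M.inner x x = p) (hy : M.inner y y = q) :
    ‖p - q‖ ≤ ‖x - y‖ ^ 2 + 2 * ‖x - y‖ * ‖y‖ := by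
  rcases proj_norm_cases q hq hqs with h | h
  · have hq0 : q = 0 := norm_eq_zero.1 h
    have h1 := M.norm_sq_eq y
    rw [hy, h] at h1
    have hy0 : y = 0 := norm_eq_zero.1 (pow_eq_zero_iff (by norm_num) |>.1 h1)
    have h2 := M.norm_sq_eq x
    rw [hx] at h2
    simp [hq0, hy0, h2]
  · have h1 := M.norm_sq_eq y
    rw [hy, h] at h1
    have hy1 : ‖y‖ = 1 := by nlinarith [norm_nonneg y]
    have a := norm_proj_mul_le M p q hp hps hq hqs x y hx hy
    have b := norm_proj_mul_le M q p hq hqs hp hps y x hy hx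
    rw [norm_sub_rev y x, ← norm_star (q * (1 - p)), star_mul, star_sub, star_one, hqs, hps] at b
    have h3 : p - q = p * (1 - q) - (1 - p) * q := by noncomm_ring
    rw [hy1, h3]
    have := norm_sub_le (p * (1 - q)) ((1 - p) * q)
    nlinarith [sq_nonneg ‖x - y‖]
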